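/- Let L = sl(3|2), acting on itself by the adjoint action A·x = ⟨A,x⟩. Then H²(L, L) = 0: every 2-cocycle of L with coefficients in the adjoint module is a 2-coboundary. -/

import Mathlib

open Matrix

variable (K : Type) [Field K]

/-- The space of matrices underlying `gl(m|n)`. -/
abbrev gl (m n : ℕ) : Type := Matrix (Fin (m + n)) (Fin (m + n)) K

/-- The parity of an index: indices `< m` are even, the rest odd. -/
def par (m n : ℕ) (i : Fin (m + n)) : ZMod 2 := if (i : ℕ) < m then 0 else 1

/-- `A` is homogeneous of parity `p`. -/
def IsHom {m n : ℕ} (p : ZMod 2) (A : gl K m n) : Prop :=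
  ∀ i j, A i j ≠ 0 → par m n i + par m n j = p

/-- The sign `(-1)^p` for `p : ZMod 2`. -/
def sg (p : ZMod 2) : K := if p = 0 then 1 else -1

/-- The even (block-diagonal) part of a matrix. -/
def evenP {m n : ℕ} (A : gl K m n) : gl K m n :=
  Matrix.of fun i j => if par m n i = par m n j then A i j else 0

/-- The odd (block-off-diagonal) part of a matrix. -/
def oddP {m n : ℕ} (A : gl K m n) : gl K m n :=
  Matrix.of fun i j => if par m n i = par m n j then 0 else A i j

/-- The super bracket `⟨A,B⟩ = AB - (-1)^{|A||B|} BA` on homogeneous elements,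
extended bilinearly to all of `gl(m|n)`. -/
def sbr {m n : ℕ} (A B : gl K m n) : gl K m n :=
  A * B - evenP K B * A - oddP K B * evenP K A + oddP K B * oddP K A

/-- The supertrace `Str(A) = Tr(a) - Tr(d)`. -/
def str {m n : ℕ} (A : gl K m n) : K := ∑ i, sg K (par m n i) * A i i

/-- `sl(m|n)`, the subspace of supertraceless matrices, as a submodule of `gl(m|n)`. -/
def sl (m n : ℕ) : Submodule K (gl K m n) where
  carrier := {A | str K A = 0}
  add_mem' {A B} hA hB := by
    simp only [Set.mem_setOf_eq, str] at *
    simp [Matrix.add_apply, mul_add, Finset.sum_add_distrib, hA, hB]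
  zero_mem' := by simp [str]
  smul_mem' c A hA := by
    simp only [Set.mem_setOf_eq, str] at *
    simp only [Matrix.smul_apply, smul_eq_mul, mul_left_comm, ← Finset.mul_sum, hA, mul_zero]

section Sign

variable {K}

lemma zmod_two_eq (p : ZMod 2) : p = 0 ∨ p = 1 := by
  revert p; decide

lemma sg_add (p q : ZMod 2) : sg K (p + q) = sg K p * sg K q := by
  rcases zmod_two_eq p with rfl | rfl <;> rcases zmod_two_eq q with rfl | rfl <;>
    simp [sg, CharTwo.add_self_eq_zero]

@[simp] lemma sg_zero : sg K 0 = 1 := by simp [sg]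

lemma sg_eq (p : ZMod 2) : sg K p = 1 ∨ sg K p = -1 := by
  unfold sg; split_ifs <;> simp

lemma sg_mul_self (p : ZMod 2) : sg K p * sg K p = 1 := by
  unfold sg; split_ifs <;> simp

end Sign

section Homogeneous

variable {K} {m n : ℕ}

lemma IsHom.zero (p : ZMod 2) : IsHom K p (0 : gl K m n) := fun _ _ h => absurd rfl h

lemma IsHom.add {p : ZMod 2} {A B : gl K m n} (hA : IsHom K p A) (hB : IsHom K p B) :
    IsHom K p (A + B) := by
  intro i j h
  by_cases hAij : A i j = 0
  · exact hB i j fun hBij => h (by simp [hAij, hBij])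
  · exact hA i j hAij

lemma IsHom.smul {p : ZMod 2} {A : gl K m n} (c : K) (hA : IsHom K p A) :
    IsHom K p (c • A) :=
  fun i j h => hA i j fun h0 => h (by simp [h0])

lemma IsHom.sub {p : ZMod 2} {A B : gl K m n} (hA : IsHom K p A) (hB : IsHom K p B) :
    IsHom K p (A - B) := by
  simpa [sub_eq_add_neg] using hA.add (hB.smul (-1))

lemma IsHom.sum {ι : Type*} {p : ZMod 2} (s : Finset ι) {A : ι → gl K m n}
    (hA : ∀ i ∈ s, IsHom K p (A i)) : IsHom K p (∑ i ∈ s, A i) :=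
  Finset.sum_induction _ _ (fun _ _ => IsHom.add) (IsHom.zero p) hA

lemma IsHom.mul {p q : ZMod 2} {A B : gl K m n} (hA : IsHom K p A) (hB : IsHom K q B) :
    IsHom K (p + q) (A * B) := by
  intro i j h
  rw [Matrix.mul_apply] at h
  obtain ⟨k, -, hk⟩ := Finset.exists_ne_zero_of_sum_ne_zero h
  rw [← hA i k (left_ne_zero_of_mul hk), ← hB k j (right_ne_zero_of_mul hk)]
  generalize par m n i = a
  generalize par m n j = b
  generalize par m n k = c
  revert a b c
  decide

lemma isHom_one : IsHom K 0 (1 : gl K m n) := by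
  intro i j h
  obtain rfl : i = j := by
    by_contra hij
    exact h (Matrix.one_apply_ne hij)
  exact CharTwo.add_self_eq_zero _

lemma isHom_single (i j : Fin (m + n)) (c : K) :
    IsHom K (par m n i + par m n j) (Matrix.single i j c : gl K m n) := by
  intro k l h
  rw [Matrix.single_apply] at h
  split_ifs at h with hkl
  · rw [hkl.1, hkl.2]
  · exact absurd rfl h

lemma IsHom.parts_of_zero {A : gl K m n} (hA : IsHom K 0 A) :
    evenP K A = A ∧ oddP K A = 0 := by
  have key : ∀ i j, A i j ≠ 0 → par m n i = par m n j :=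
    fun i j h => CharTwo.add_eq_zero.mp (hA i j h)
  constructor <;> ext i j <;> by_cases h : A i j = 0 <;> simp [evenP, oddP, h] <;>
    simp [key i j h]

lemma IsHom.parts_of_one {A : gl K m n} (hA : IsHom K 1 A) :
    evenP K A = 0 ∧ oddP K A = A := by
  have key : ∀ i j, A i j ≠ 0 → par m n i ≠ par m n j := by
    intro i j h heq
    have h1 := hA i j h
    rw [heq, CharTwo.add_self_eq_zero] at h1
    exact absurd h1 (by decide)
  constructor <;> ext i j <;> by_cases h : A i j = 0 <;> simp_all [evenP, oddP]

/-- On homogeneous elements the super bracket is the super commutator. -/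
lemma sbr_of_isHom {p q : ZMod 2} {A B : gl K m n} (hA : IsHom K p A) (hB : IsHom K q B) :
    sbr K A B = A * B - sg K (p * q) • (B * A) := by
  rcases zmod_two_eq p with rfl | rfl <;> rcases zmod_two_eq q with rfl | rfl <;>
    first
    | simp [sbr, sg, hA.parts_of_zero.1, hA.parts_of_zero.2, hB.parts_of_zero.1,
        hB.parts_of_zero.2]
    | simp [sbr, sg, hA.parts_of_zero.1, hA.parts_of_zero.2, hB.parts_of_one.1,
        hB.parts_of_one.2]
    | simp [sbr, sg, hA.parts_of_one.1, hA.parts_of_one.2, hB.parts_of_zero.1,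
        hB.parts_of_zero.2]
    | simp [sbr, sg, hA.parts_of_one.1, hA.parts_of_one.2, hB.parts_of_one.1,
        hB.parts_of_one.2]

lemma IsHom.sbr {p q : ZMod 2} {A B : gl K m n} (hA : IsHom K p A) (hB : IsHom K q B) :
    IsHom K (p + q) (sbr K A B) := by
  rw [sbr_of_isHom hA hB]
  exact (hA.mul hB).sub ((add_comm q p ▸ hB.mul hA).smul _)

/-- The super Jacobi identity, in the form saying that the adjoint action is a module. -/
lemma sbr_sbr {p q r : ZMod 2} {A B X : gl K m n} (hA : IsHom K p A) (hB : IsHom K q B)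
    (hX : IsHom K r X) :
    sbr K A (sbr K B X) = sg K (p * q) • sbr K B (sbr K A X) + sbr K (sbr K A B) X := by
  rw [sbr_of_isHom hA (hB.sbr hX), sbr_of_isHom hB (hA.sbr hX), sbr_of_isHom (hA.sbr hB) hX,
    sbr_of_isHom hA hB, sbr_of_isHom hA hX, sbr_of_isHom hB hX]
  simp only [mul_add, add_mul, sg_add, mul_comm q p]
  rcases sg_eq (K := K) (p * q) with h | h <;> rcases sg_eq (K := K) (p * r) with h' | h' <;>
    rcases sg_eq (K := K) (q * r) with h'' | h'' <;> rw [h, h', h''] <;>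
    simp only [one_smul, neg_smul, mul_one, mul_neg, neg_neg] <;> noncomm_ring

end Homogeneous

section Bilinear

variable (m n : ℕ)

/-- The super bracket as a bilinear map. -/
def sbrHom : gl K m n →ₗ[K] gl K m n →ₗ[K] gl K m n :=
  have evenP_add (A B : gl K m n) : evenP K (A + B) = evenP K A + evenP K B := by
    ext i j; simp only [evenP, Matrix.of_apply, Matrix.add_apply]; split_ifs <;> simp
  have oddP_add (A B : gl K m n) : oddP K (A + B) = oddP K A + oddP K B := by
    ext i j; simp only [oddP, Matrix.of_apply, Matrix.add_apply]; split_ifs <;> simp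
  have evenP_smul (c : K) (A : gl K m n) : evenP K (c • A) = c • evenP K A := by
    ext i j; simp [evenP]
  have oddP_smul (c : K) (A : gl K m n) : oddP K (c • A) = c • oddP K A := by
    ext i j; simp [oddP]
  LinearMap.mk₂ K (sbr K)
    (fun A A' B => by
      simp only [sbr, evenP_add, oddP_add, add_mul, mul_add]; abel)
    (fun c A B => by
      simp only [sbr, evenP_smul, oddP_smul, Matrix.smul_mul, Matrix.mul_smul, smul_sub, smul_add])
    (fun A B B' => by
      simp only [sbr, evenP_add, oddP_add, add_mul, mul_add]; abel)
    (fun c A B => by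
      simp only [sbr, evenP_smul, oddP_smul, Matrix.smul_mul, Matrix.mul_smul, smul_sub, smul_add])

/-- The supertrace as a linear functional. -/
def strHom : gl K m n →ₗ[K] K where
  toFun := str K
  map_add' A B := by simp [str, mul_add, Finset.sum_add_distrib]
  map_smul' c A := by simp [str, Finset.mul_sum, mul_left_comm]

variable {K m n}

@[simp] lemma sbrHom_apply (A B : gl K m n) : sbrHom K m n A B = sbr K A B := rfl

@[simp] lemma strHom_apply (A : gl K m n) : strHom K m n A = str K A := rfl

lemma mem_sl {A : gl K m n} : A ∈ sl K m n ↔ str K A = 0 := Iff.rfl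

lemma str_single (i j : Fin (m + n)) :
    str K (Matrix.single i j 1 : gl K m n) = if i = j then sg K (par m n i) else 0 := by
  have h (k : Fin (m + n)) : sg K (par m n k) * (Matrix.single i j 1 : gl K m n) k k =
      if k = i then (if i = j then sg K (par m n i) else 0) else 0 := by
    rw [Matrix.single_apply]
    split_ifs <;> simp_all
  simp [str, h]

lemma sbr_single (i j k l : Fin (m + n)) :
    sbr K (Matrix.single i j 1 : gl K m n) (Matrix.single k l 1) =
      (if j = k then Matrix.single i l 1 else 0) -
        sg K ((par m n i + par m n j) * (par m n k + par m n l)) •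
          (if l = i then Matrix.single k j 1 else 0) := by
  rw [sbr_of_isHom (isHom_single i j 1) (isHom_single k l 1)]
  congr 2
  · split_ifs with h
    · subst h; simp
    · simp [h]
  · split_ifs with h
    · subst h; simp
    · simp [h]

lemma linearMap_ext_single {M : Type*} [AddCommGroup M] [Module K M] {g h : gl K m n →ₗ[K] M}
    (H : ∀ i j, g (Matrix.single i j 1) = h (Matrix.single i j 1)) : g = h :=
  (Matrix.stdBasis K (Fin (m + n)) (Fin (m + n))).ext fun ⟨i, j⟩ => by
    rw [Matrix.stdBasis_eq_single]
    exact H i j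

/-- The supertrace vanishes on super brackets. -/
lemma str_sbr (A B : gl K m n) : str K (sbr K A B) = 0 := by
  suffices h : (sbrHom K m n).compr₂ (strHom K m n) = 0 from LinearMap.congr_fun₂ h A B
  refine linearMap_ext_single fun i j => linearMap_ext_single fun k l => ?_
  simp only [LinearMap.compr₂_apply, sbrHom_apply, sbr_single, map_sub, map_smul, strHom_apply,
    LinearMap.zero_apply, smul_eq_mul]
  by_cases hjk : j = k
  · by_cases hli : l = i
    · subst hjk hli
      simp only [if_true, str_single, ← sg_add, sub_eq_zero]
      congr 1
      generalize par m n l = a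
      generalize par m n j = b
      revert a b
      decide
    · simp [hjk, hli, ← strHom_apply]
      simp [str_single, Ne.symm hli]
  · by_cases hli : l = i
    · simp [hjk, hli, ← strHom_apply]
      simp [str_single, Ne.symm hjk]
    · simp [hjk, hli, ← strHom_apply]

lemma sbr_mem_sl (A B : gl K m n) : sbr K A B ∈ sl K m n := str_sbr A B

lemma sbr_one_left (A : gl K m n) : sbr K 1 A = 0 := by
  suffices h : sbrHom K m n 1 = 0 from LinearMap.congr_fun h A
  refine linearMap_ext_single fun i j => ?_
  simp [sbr_of_isHom isHom_one (isHom_single (K := K) i j 1)]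

end Bilinear

section Casimir

variable {K} {m n : ℕ}

lemma sum_map_sbr_single {M : Type*} [AddCommGroup M] [Module K M] (k l : Fin (m + n))
    (g : Fin (m + n) → Fin (m + n) → gl K m n →ₗ[K] M) :
    ∑ i, ∑ j, g i j (sbr K (Matrix.single i j 1) (Matrix.single k l 1)) =
      ∑ i, g i k (Matrix.single i l 1) -
        ∑ j, sg K ((par m n l + par m n j) * (par m n k + par m n l)) •
          g l j (Matrix.single k j 1) := by
  simp only [sbr_single, map_sub, map_smul, Finset.sum_sub_distrib]
  congr 1
  · simp only [apply_ite (g _ _), map_zero, Finset.sum_ite_eq', Finset.mem_univ, if_true]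
  · rw [Finset.sum_comm]
    simp only [apply_ite (g _ _), map_zero, smul_ite, smul_zero, Finset.sum_ite_eq,
      Finset.mem_univ, if_true]

/-- Invariance of the Casimir tensor of `gl(m|n)`, twisted by the parity `p` of a cochain. -/
lemma casimir_invariant {M : Type*} [AddCommGroup M] [Module K M] (p a : ZMod 2)
    {A : gl K m n} (hA : IsHom K a A) (G : gl K m n →ₗ[K] gl K m n →ₗ[K] M) :
    ∑ i, ∑ j, sg K (p * (par m n i + par m n j) + par m n j) •
      (sg K ((par m n i + par m n j) * a + p * a) •
          G (sbr K (Matrix.single i j 1) A) (Matrix.single j i 1) +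
        G (Matrix.single i j 1) (sbr K (Matrix.single j i 1) A)) = 0 := by
  let T : gl K m n →ₗ[K] M :=
    ∑ i, ∑ j, sg K (p * (par m n i + par m n j) + par m n j) •
      (sg K ((par m n i + par m n j) * a + p * a) •
          (G.flip (Matrix.single j i 1)).comp (sbrHom K m n (Matrix.single i j 1)) +
        (G (Matrix.single i j 1)).comp (sbrHom K m n (Matrix.single j i 1)))
  suffices h : T A = 0 by simpa [T] using h
  rw [Matrix.matrix_eq_sum_single A, map_sum]
  refine Finset.sum_eq_zero fun k _ => ?_
  rw [map_sum]
  refine Finset.sum_eq_zero fun l _ => ?_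
  by_cases hkl : A k l = 0
  · simp [hkl]
  obtain rfl := hA k l hkl
  rw [← mul_one (A k l), ← smul_eq_mul, ← Matrix.smul_single, map_smul]
  convert smul_zero _
  have h₁ := sum_map_sbr_single k l fun i j =>
    (sg K (p * (par m n i + par m n j) + par m n j) *
      sg K ((par m n i + par m n j) * (par m n k + par m n l) + p * (par m n k + par m n l))) •
        G.flip (Matrix.single j i 1)
  have h₂ := sum_map_sbr_single k l fun j i =>
    sg K (p * (par m n i + par m n j) + par m n j) • G (Matrix.single i j 1)
  rw [Finset.sum_comm] at h₂
  simp only [T, LinearMap.sum_apply, LinearMap.smul_apply, LinearMap.add_apply,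
    LinearMap.comp_apply, sbrHom_apply, smul_add, Finset.sum_add_distrib, smul_smul]
  simp only [LinearMap.smul_apply, smul_smul] at h₁ h₂
  rw [h₁, h₂]
  simp only [LinearMap.flip_apply, ← sg_add]
  rw [sub_add_sub_comm, sub_eq_zero, add_comm]
  clear h₁ h₂
  refine congrArg₂ _ (Finset.sum_congr rfl fun j _ => ?_) (Finset.sum_congr rfl fun i _ => ?_)
  · congr 2
    generalize par m n j = b
    generalize par m n k = c
    generalize par m n l = d
    revert p b c d
    decide
  · congr 2
    generalize par m n i = b
    generalize par m n k = c
    generalize par m n l = d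
    revert p b c d
    decide

/-- The Casimir element of `gl(m|n)` acts on the adjoint module of `sl(m|n)` by a scalar. -/
lemma casimir_apply {x : gl K m n} (hx : x ∈ sl K m n) :
    ∑ i, ∑ j, sg K (par m n j) •
      sbr K (Matrix.single i j 1) (sbr K (Matrix.single j i 1) x) =
        (2 * str K (1 : gl K m n)) • x := by
  suffices h : ∑ i, ∑ j, sg K (par m n j) •
      (sbrHom K m n (Matrix.single i j 1)).comp (sbrHom K m n (Matrix.single j i 1)) =
      (2 * str K (1 : gl K m n)) • LinearMap.id -
        (2 : K) • (strHom K m n).smulRight (1 : gl K m n) by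
    simpa [mem_sl.mp hx] using LinearMap.congr_fun h x
  refine linearMap_ext_single fun k l => ?_
  have h := sum_map_sbr_single k l fun j i =>
    sg K (par m n j) • sbrHom K m n (Matrix.single i j 1)
  rw [Finset.sum_comm] at h
  simp only [LinearMap.smul_apply, sbrHom_apply] at h
  simp only [LinearMap.sum_apply, LinearMap.smul_apply, LinearMap.comp_apply, sbrHom_apply,
    LinearMap.sub_apply, LinearMap.id_apply, LinearMap.smulRight_apply, strHom_apply, str_single]
  rw [h]
  simp only [sbr_single, if_true, smul_sub, smul_smul, Finset.sum_sub_distrib, ← Finset.sum_smul,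
    ← sg_add]
  have hone : str K (1 : gl K m n) = ∑ i, sg K (par m n i) := by simp [str]
  have h₁ : ∀ i, (par m n l + par m n i) * (par m n k + par m n l) + (par m n l +
      (par m n i + par m n l) * (par m n k + par m n i)) = par m n i := by
    intro i
    generalize par m n i = b
    generalize par m n k = c
    generalize par m n l = d
    revert b c d
    decide
  simp only [h₁, hone]
  by_cases hkl : k = l
  · subst hkl
    have h₂ : ∀ i, par m n i + (par m n k + par m n i) * (par m n i + par m n k) = par m n k := by
      intro i
      generalize par m n i = b
      generalize par m n k = c
      revert b c
      decide
    have h₃ : ∀ i, (par m n k + par m n i) * (par m n k + par m n k) + par m n k = par m n k := by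
      intro i
      simp [CharTwo.add_self_eq_zero]
    simp only [h₂, h₃, if_true, ← Finset.smul_sum, Matrix.sum_single_one]
    module
  · simp only [if_neg hkl, if_neg (Ne.symm hkl), smul_zero, Finset.sum_const_zero]
    module

end Casimir

section Projection

variable {K} {m n : ℕ}

/-- The projection of `gl(m|n)` onto `sl(m|n)` along the scalar matrices, for `m ≠ n`. -/
def slProj (h : str K (1 : gl K m n) ≠ 0) : gl K m n →ₗ[K] ↥(sl K m n) :=
  LinearMap.codRestrict (sl K m n)
    (LinearMap.id - (str K (1 : gl K m n))⁻¹ • (strHom K m n).smulRight (1 : gl K m n)) fun A => by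
      rw [mem_sl, ← strHom_apply]
      simp only [LinearMap.sub_apply, LinearMap.smul_apply, LinearMap.smulRight_apply, map_sub,
        map_smul, LinearMap.id_apply, strHom_apply, smul_eq_mul]
      field_simp
      ring

lemma coe_slProj (h : str K (1 : gl K m n) ≠ 0) (A : gl K m n) :
    (slProj h A : gl K m n) = A - ((str K (1 : gl K m n))⁻¹ * str K A) • 1 := by
  simp [slProj, smul_smul]

lemma slProj_coe (h : str K (1 : gl K m n) ≠ 0) (A : ↥(sl K m n)) : slProj h A = A := by
  ext1
  simp [coe_slProj, mem_sl.mp A.2]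

lemma sbr_slProj (h : str K (1 : gl K m n) ≠ 0) (A B : gl K m n) :
    sbr K (slProj h A : gl K m n) B = sbr K A B := by
  rw [coe_slProj, ← sbrHom_apply, map_sub, map_smul]
  simp [sbr_one_left]

lemma isHom_slProj_single (h : str K (1 : gl K m n) ≠ 0) (i j : Fin (m + n)) :
    IsHom K (par m n i + par m n j) (slProj h (Matrix.single i j 1) : gl K m n) := by
  rw [coe_slProj, str_single]
  refine (isHom_single i j 1).sub ?_
  split_ifs with hij
  · subst hij
    rw [CharTwo.add_self_eq_zero]
    exact isHom_one.smul _
  · simpa using IsHom.zero _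

end Projection

section Homotopy

variable {K} {m n : ℕ}

lemma smul_sbr_sbr (p : ZMod 2) {q a r : ZMod 2} {E A X : gl K m n} (hE : IsHom K q E)
    (hA : IsHom K a A) (hX : IsHom K r X) :
    sg K (q * a + p * a) • sbr K E (sbr K A X) =
      sg K (p * a) • sbr K A (sbr K E X) + sg K (q * a + p * a) • sbr K (sbr K E A) X := by
  rw [sbr_sbr hE hA hX, smul_add, smul_smul, sg_add, mul_right_comm, sg_mul_self, one_mul]

/-- If `m ≠ n`, every 2-cocycle of `sl(m|n)` with values in the adjoint module is a coboundary:
contracting with the Casimir tensor provides a homotopy. -/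
theorem two_cocycle_is_coboundary [CharZero K] (h1 : str K (1 : gl K m n) ≠ 0)
    (p : ZMod 2) (f : ↥(sl K m n) →ₗ[K] ↥(sl K m n) →ₗ[K] gl K m n)
    (hgrade : ∀ (pA pB : ZMod 2) (A B : ↥(sl K m n)),
      IsHom K pA (A : gl K m n) → IsHom K pB (B : gl K m n) →
      f A B ∈ sl K m n ∧ IsHom K (pA + pB + p) (f A B))
    (hcocycle : ∀ (pA pB pC : ZMod 2) (A B C AB AC BC : ↥(sl K m n)),
      IsHom K pA (A : gl K m n) → IsHom K pB (B : gl K m n) → IsHom K pC (C : gl K m n) →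
      (AB : gl K m n) = sbr K ↑A ↑B → (AC : gl K m n) = sbr K ↑A ↑C →
      (BC : gl K m n) = sbr K ↑B ↑C →
      sg K (p * pA) • sbr K (A : gl K m n) (f B C)
        - sg K (pA * pB + p * pB) • sbr K (B : gl K m n) (f A C)
        + sg K ((pA + pB) * pC + p * pC) • sbr K (C : gl K m n) (f A B)
        - f AB C + sg K (pB * pC) • f AC B + f A BC = 0) :
    ∃ φ : ↥(sl K m n) →ₗ[K] gl K m n,
      (∀ (q : ZMod 2) (A : ↥(sl K m n)), IsHom K q (A : gl K m n) →
        φ A ∈ sl K m n ∧ IsHom K (q + p) (φ A)) ∧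
      ∀ (pA pB : ZMod 2) (A B AB : ↥(sl K m n)),
        IsHom K pA (A : gl K m n) → IsHom K pB (B : gl K m n) →
        (AB : gl K m n) = sbr K ↑A ↑B →
        f A B = sg K (p * pA) • sbr K (A : gl K m n) (φ B)
          - sg K (pA * pB + p * pB) • sbr K (B : gl K m n) (φ A) - φ AB := by
  let w (i j : Fin (m + n)) : K := sg K (p * (par m n i + par m n j) + par m n j)
  let e (i j : Fin (m + n)) : gl K m n := Matrix.single i j 1
  let Φ : ↥(sl K m n) →ₗ[K] gl K m n :=
    ∑ i, ∑ j, w i j • (sbrHom K m n (e i j)).comp (f (slProj h1 (e j i)))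
  have hΦ (A) : Φ A = ∑ i, ∑ j, w i j • sbr K (e i j) (f (slProj h1 (e j i)) A) := by
    simp [Φ]
  have hc : (2 * str K (1 : gl K m n)) ≠ 0 := mul_ne_zero two_ne_zero h1
  have he (i j) : IsHom K (par m n i + par m n j) (e i j) := isHom_single i j 1
  have hfe {q : ZMod 2} {A : ↥(sl K m n)} (hA : IsHom K q (A : gl K m n)) (i j) :
      IsHom K (par m n i + par m n j + q + p) (f (slProj h1 (e j i)) A) := by
    rw [add_comm (par m n i)]
    exact (hgrade _ _ _ _ (isHom_slProj_single h1 j i) hA).2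
  refine ⟨(2 * str K (1 : gl K m n))⁻¹ • Φ, fun q A hA => ⟨?_, ?_⟩, ?_⟩
  · rw [LinearMap.smul_apply, hΦ]
    exact Submodule.smul_mem _ _ <| Submodule.sum_mem _ fun i _ => Submodule.sum_mem _ fun j _ =>
      Submodule.smul_mem _ _ (sbr_mem_sl _ _)
  · rw [LinearMap.smul_apply, hΦ]
    refine (IsHom.sum _ fun i _ => IsHom.sum _ fun j _ => IsHom.smul _ ?_).smul _
    have := (he i j).sbr (hfe hA i j)
    rwa [add_assoc _ q p, ← add_assoc, CharTwo.add_self_eq_zero, zero_add] at this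
  intro a b A B AB hA hB hAB
  have hinv {d : ZMod 2} {X : gl K m n} (hX : IsHom K d X) (Y : ↥(sl K m n)) :
      ∑ i, ∑ j, w i j • (sg K ((par m n i + par m n j) * d + p * d) •
        sbr K (sbr K (e i j) X) (f (slProj h1 (e j i)) Y) +
          sbr K (e i j) (f (slProj h1 (sbr K (e j i) X)) Y)) = 0 := by
    simpa using casimir_invariant p d hX ((sbrHom K m n).compl₂ ((f.flip Y).comp (slProj h1)))
  have hterm (i j : Fin (m + n)) : sg K (par m n j) • sbr K (e i j) (sbr K (e j i) (f A B)) =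
      sg K (p * a) • w i j • sbr K A (sbr K (e i j) (f (slProj h1 (e j i)) B)) -
      sg K (a * b + p * b) • w i j • sbr K B (sbr K (e i j) (f (slProj h1 (e j i)) A)) -
      w i j • sbr K (e i j) (f (slProj h1 (e j i)) AB) +
      w i j • (sg K ((par m n i + par m n j) * a + p * a) •
        sbr K (sbr K (e i j) A) (f (slProj h1 (e j i)) B) +
          sbr K (e i j) (f (slProj h1 (sbr K (e j i) A)) B)) -
      sg K (a * b) • w i j • (sg K ((par m n i + par m n j) * b + p * b) •
        sbr K (sbr K (e i j) B) (f (slProj h1 (e j i)) A) +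
          sbr K (e i j) (f (slProj h1 (sbr K (e j i) B)) A)) := by
    have key := hcocycle (par m n i + par m n j) a b (slProj h1 (e j i)) A B
      (slProj h1 (sbr K (e j i) A)) (slProj h1 (sbr K (e j i) B)) AB
      (add_comm (par m n j) _ ▸ isHom_slProj_single h1 j i) hA hB
      (by rw [sbr_slProj]; exact congrArg _ (slProj_coe h1 ⟨_, sbr_mem_sl _ _⟩))
      (by rw [sbr_slProj]; exact congrArg _ (slProj_coe h1 ⟨_, sbr_mem_sl _ _⟩)) hAB
    rw [sbr_slProj] at key
    have key' := congrArg (sbrHom K m n (e i j)) key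
    simp only [map_add, map_sub, map_smul, map_zero, sbrHom_apply] at key'
    have hA' := smul_sbr_sbr p (he i j) hA (hfe hB i j)
    have hB' := smul_sbr_sbr p (he i j) hB (hfe hA i j)
    have hj : sg K (par m n j) = w i j * sg K (p * (par m n i + par m n j)) := by
      simp only [w, sg_add]
      rw [mul_right_comm, sg_mul_self, one_mul]
    rw [hj]
    simp only [add_mul _ _ b, sg_add] at key' hA' hB' ⊢
    linear_combination (norm := module) w i j • key' + w i j • hA' - (w i j * sg K (a * b)) • hB'
  have hsum : (2 * str K (1 : gl K m n)) • f A B = sg K (p * a) • sbr K A (Φ B) -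
      sg K (a * b + p * b) • sbr K B (Φ A) - Φ AB := by
    rw [← casimir_apply (hgrade a b A B hA hB).1]
    refine (Finset.sum_congr rfl fun i _ => Finset.sum_congr rfl fun j _ => hterm i j).trans ?_
    simp only [Finset.sum_add_distrib, Finset.sum_sub_distrib, ← Finset.smul_sum, hinv hA, hinv hB]
    simp only [hΦ, ← sbrHom_apply, map_sum, map_smul, smul_zero, add_zero, sub_zero]
  rw [← inv_smul_smul₀ hc (f A B), hsum]
  simp only [LinearMap.smul_apply, ← sbrHom_apply, map_smul]
  module

end Homotopy

/-- Let `L = sl(3|2)` act on itself by the adjoint action `A·x = ⟨A,x⟩`.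
Then `H²(L,L) = 0`: every 2-cocycle of `L` with coefficients in the adjoint module is a
2-coboundary. -/
theorem second_cohomology_sl_3_2_adjoint_module
    (K : Type) [Field K] [IsAlgClosed K] [CharZero K]
    (p : ZMod 2) (f : ↥(sl K 3 2) →ₗ[K] ↥(sl K 3 2) →ₗ[K] gl K 3 2)
    -- `f` is a 2-cochain of parity `p` with values in `L` ...
    (hgrade : ∀ (pA pB : ZMod 2) (A B : ↥(sl K 3 2)),
      IsHom K pA (A : gl K 3 2) → IsHom K pB (B : gl K 3 2) →
      f A B ∈ sl K 3 2 ∧ IsHom K (pA + pB + p) (f A B))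
    (hskew : ∀ (pA pB : ZMod 2) (A B : ↥(sl K 3 2)),
      IsHom K pA (A : gl K 3 2) → IsHom K pB (B : gl K 3 2) →
      f B A = -(sg K (pA * pB) • f A B))
    -- ... satisfying the 2-cocycle identity for the adjoint action:
    (hcocycle : ∀ (pA pB pC : ZMod 2) (A B C AB AC BC : ↥(sl K 3 2)),
      IsHom K pA (A : gl K 3 2) → IsHom K pB (B : gl K 3 2) → IsHom K pC (C : gl K 3 2) →
      (AB : gl K 3 2) = sbr K ↑A ↑B → (AC : gl K 3 2) = sbr K ↑A ↑C →
      (BC : gl K 3 2) = sbr K ↑B ↑C →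
      sg K (p * pA) • sbr K (A : gl K 3 2) (f B C)
        - sg K (pA * pB + p * pB) • sbr K (B : gl K 3 2) (f A C)
        + sg K ((pA + pB) * pC + p * pC) • sbr K (C : gl K 3 2) (f A B)
        - f AB C + sg K (pB * pC) • f AC B + f A BC = 0) :
    -- then `f` is a 2-coboundary:
    ∃ φ : ↥(sl K 3 2) →ₗ[K] gl K 3 2,
      (∀ (q : ZMod 2) (A : ↥(sl K 3 2)), IsHom K q (A : gl K 3 2) →
        φ A ∈ sl K 3 2 ∧ IsHom K (q + p) (φ A)) ∧
      ∀ (pA pB : ZMod 2) (A B AB : ↥(sl K 3 2)),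
        IsHom K pA (A : gl K 3 2) → IsHom K pB (B : gl K 3 2) →
        (AB : gl K 3 2) = sbr K ↑A ↑B →
        f A B = sg K (p * pA) • sbr K (A : gl K 3 2) (φ B)
          - sg K (pA * pB + p * pB) • sbr K (B : gl K 3 2) (φ A) - φ AB := by
  refine two_cocycle_is_coboundary ?_ p f hgrade hcocycle
  simp [str, par, sg, Fin.sum_univ_succ]
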